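/- Let n ≥ 2 and let B ⊂ ℝ^{n+1} be a convex body (a compact convex set with nonempty interior) that is symmetric about the origin (B = -B) and contains the origin in its interior. If there is a constant c such that for every n-dimensional linear subspace H of ℝ^{n+1} the n-dimensional volume (n-dimensional Hausdorff measure) of B ∩ H equals c, then B is a closed Euclidean ball centered at the origin. -/

import Mathlib

open Metric MeasureTheory
open scoped ENNReal

noncomputable section

namespace CentralSections

/-- The linear map sending the `i`-th standard basis vector to `T i`. -/
def frameMap {n d : ℕ} (T : Fin n → EuclideanSpace ℝ (Fin d)) :
    EuclideanSpace ℝ (Fin n) →ₗ[ℝ] EuclideanSpace ℝ (Fin d) :=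
  (EuclideanSpace.basisFun (Fin n) ℝ).toBasis.constr ℝ T

lemma frameMap_apply {n d : ℕ} (T : Fin n → EuclideanSpace ℝ (Fin d))
    (y : EuclideanSpace ℝ (Fin n)) : frameMap T y = ∑ i, y i • T i := by
  simp [frameMap, Module.Basis.constr_apply_fintype]

lemma frameMap_single {n d : ℕ} (T : Fin n → EuclideanSpace ℝ (Fin d)) (i : Fin n) :
    frameMap T (EuclideanSpace.basisFun (Fin n) ℝ i) = T i := by
  have h := (EuclideanSpace.basisFun (Fin n) ℝ).toBasis.constr_basis ℝ T i
  rwa [OrthonormalBasis.coe_toBasis] at h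

/-- The determinant of the `n + 1` vectors `p, T 0, …, T (n - 1)`. -/
def frameDet {n : ℕ} (p : EuclideanSpace ℝ (Fin (n + 1)))
    (T : Fin n → EuclideanSpace ℝ (Fin (n + 1))) : ℝ :=
  (EuclideanSpace.basisFun (Fin (n + 1)) ℝ).toBasis.det.curryLeft p T

lemma frameDet_eq {n : ℕ} (p : EuclideanSpace ℝ (Fin (n + 1)))
    (T : Fin n → EuclideanSpace ℝ (Fin (n + 1))) :
    frameDet p T = (EuclideanSpace.basisFun (Fin (n + 1)) ℝ).toBasis.det (Fin.cons p T) := rfl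

/-- The determinant of a linear involution squares to one. -/
lemma sq_det_eq_one_of_involutive {M : Type*} [AddCommGroup M] [Module ℝ M] (f : M →ₗ[ℝ] M)
    (hf : ∀ x, f (f x) = x) : LinearMap.det f ^ 2 = 1 := by
  have : f ∘ₗ f = LinearMap.id := LinearMap.ext hf
  rw [sq, ← LinearMap.det_comp, this, LinearMap.det_id]

lemma frameDet_map_sq {n : ℕ}
    (U : EuclideanSpace ℝ (Fin (n + 1)) →ₗ[ℝ] EuclideanSpace ℝ (Fin (n + 1)))
    (hU : ∀ x, U (U x) = x) (p : EuclideanSpace ℝ (Fin (n + 1)))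
    (T : Fin n → EuclideanSpace ℝ (Fin (n + 1))) :
    frameDet (U p) (fun i => U (T i)) ^ 2 = frameDet p T ^ 2 := by
  have h : (Fin.cons (U p) (fun i => U (T i)) : Fin (n + 1) → EuclideanSpace ℝ (Fin (n + 1)))
      = U ∘ (Fin.cons p T : Fin (n + 1) → EuclideanSpace ℝ (Fin (n + 1))) := by
    funext i
    refine Fin.cases ?_ (fun j => ?_) i <;> simp
  rw [frameDet_eq, frameDet_eq, h, Module.Basis.det_comp, mul_pow, sq_det_eq_one_of_involutive U hU,
    one_mul]

lemma frameDet_smul_left {n : ℕ} (c : ℝ) (p : EuclideanSpace ℝ (Fin (n + 1)))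
    (T : Fin n → EuclideanSpace ℝ (Fin (n + 1))) :
    frameDet (c • p) T = c * frameDet p T := by
  simp only [frameDet, map_smul, AlternatingMap.smul_apply, smul_eq_mul]

lemma frameDet_eq_zero_of_not_linearIndependent {n : ℕ} (p : EuclideanSpace ℝ (Fin (n + 1)))
    (T : Fin n → EuclideanSpace ℝ (Fin (n + 1))) (h : ¬ LinearIndependent ℝ T) :
    frameDet p T = 0 := by
  rw [frameDet]
  exact AlternatingMap.map_linearDependent _ _ h

lemma frameDet_cons_smul {m : ℕ} (c : ℝ) (p x : EuclideanSpace ℝ (Fin (m + 1 + 1)))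
    (S : Fin m → EuclideanSpace ℝ (Fin (m + 1 + 1))) :
    frameDet p (Fin.cons (c • x) S) = c * frameDet p (Fin.cons x S) := by
  rw [frameDet, frameDet]
  exact ((EuclideanSpace.basisFun (Fin (m + 1 + 1)) ℝ).toBasis.det.curryLeft
    p).toMultilinearMap.cons_smul
    S c x

lemma frameDet_add_smul {m : ℕ} (c : ℝ) (p x : EuclideanSpace ℝ (Fin (m + 1 + 1)))
    (S : Fin m → EuclideanSpace ℝ (Fin (m + 1 + 1))) :
    frameDet (p + c • x) (Fin.cons x S) = frameDet p (Fin.cons x S) := by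
  have h : frameDet x (Fin.cons x S) = 0 := by
    rw [frameDet_eq]
    exact AlternatingMap.map_eq_zero_of_eq _ _ (i := 0) (j := 1) (by simp) (by simp)
  have h2 : frameDet (p + c • x) (Fin.cons x S)
      = frameDet p (Fin.cons x S) + c * frameDet x (Fin.cons x S) := by
    simp only [frameDet, map_add, map_smul, AlternatingMap.add_apply, AlternatingMap.smul_apply,
      smul_eq_mul]
  rw [h2, h, mul_zero, add_zero]

lemma continuous_frameDet {n : ℕ} (p : EuclideanSpace ℝ (Fin (n + 1))) :
    Continuous fun T : Fin n → EuclideanSpace ℝ (Fin (n + 1)) => frameDet p T := by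
  simp only [frameDet_eq, Module.Basis.det_apply]
  refine Continuous.matrix_det (continuous_matrix fun i j => ?_)
  simp only [Module.Basis.toMatrix_apply]
  refine Fin.cases ?_ (fun k => ?_) j
  · simpa using continuous_const
  · simp; fun_prop

lemma abs_frameDet_cons_le {m : ℕ} (p x : EuclideanSpace ℝ (Fin (m + 1 + 1))) (hp : ‖p‖ = 1)
    (hx : ‖x‖ = 1) (S : Fin m → EuclideanSpace ℝ (Fin (m + 1 + 1))) :
    |frameDet p (Fin.cons x S)| ≤ ∏ i, ‖S i‖ := by
  have : Fact (Module.finrank ℝ (EuclideanSpace ℝ (Fin (m + 1 + 1))) = m + 1 + 1) := ⟨by simp⟩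
  set b := EuclideanSpace.basisFun (Fin (m + 1 + 1)) ℝ
  have h := (b.toBasis.orientation).abs_volumeForm_apply_le
    (Fin.cons p (Fin.cons x S) : Fin (m + 1 + 1) → EuclideanSpace ℝ (Fin (m + 1 + 1)))
  rw [Orientation.volumeForm_robust _ b rfl] at h
  rw [frameDet_eq]
  simpa [Fin.prod_univ_succ, hp, hx] using h

/-- Precomposition of a frame, seen as a linear map, with an endomorphism `V`. -/
def frameComp {n d : ℕ} (V : EuclideanSpace ℝ (Fin n) →ₗ[ℝ] EuclideanSpace ℝ (Fin n)) :
    (Fin n → EuclideanSpace ℝ (Fin d)) →ₗ[ℝ] (Fin n → EuclideanSpace ℝ (Fin d)) where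
  toFun T i := frameMap T (V (EuclideanSpace.basisFun (Fin n) ℝ i))
  map_add' S T := by
    funext i
    simp [frameMap_apply, Finset.sum_add_distrib]
  map_smul' c T := by
    funext i
    simp [frameMap_apply, Finset.smul_sum, smul_comm c]

lemma frameMap_frameComp {n d : ℕ} (V : EuclideanSpace ℝ (Fin n) →ₗ[ℝ] EuclideanSpace ℝ (Fin n))
    (T : Fin n → EuclideanSpace ℝ (Fin d)) : frameMap (frameComp V T) = frameMap T ∘ₗ V := by
  refine (EuclideanSpace.basisFun (Fin n) ℝ).toBasis.ext fun i => ?_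
  have := frameMap_single (frameComp V T) i
  simpa [frameComp] using this

lemma frameComp_involutive {n d : ℕ}
    (V : EuclideanSpace ℝ (Fin n) →ₗ[ℝ] EuclideanSpace ℝ (Fin n)) (hV : ∀ y, V (V y) = y)
    (T : Fin n → EuclideanSpace ℝ (Fin d)) : frameComp V (frameComp V T) = T := by
  funext i
  change frameMap (frameComp V T) (V (EuclideanSpace.basisFun (Fin n) ℝ i)) = T i
  rw [frameMap_frameComp, LinearMap.comp_apply, hV, frameMap_single]

lemma frameDet_frameComp_sq {n : ℕ}
    (V : EuclideanSpace ℝ (Fin n) →ₗ[ℝ] EuclideanSpace ℝ (Fin n)) (hV : ∀ y, V (V y) = y)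
    (p : EuclideanSpace ℝ (Fin (n + 1))) (T : Fin n → EuclideanSpace ℝ (Fin (n + 1))) :
    frameDet p (frameComp V T) ^ 2 = frameDet p T ^ 2 := by
  set b := EuclideanSpace.basisFun (Fin n) ℝ with hb
  set ψ : EuclideanSpace ℝ (Fin n) [⋀^Fin n]→ₗ[ℝ] ℝ :=
    ((EuclideanSpace.basisFun (Fin (n + 1)) ℝ).toBasis.det.curryLeft p).compLinearMap (frameMap T)
    with hψ
  have h1 : frameDet p (frameComp V T) = ψ (V ∘ b.toBasis) := by
    rw [frameDet, hψ, AlternatingMap.compLinearMap_apply]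
    congr 1
  have h2 : frameDet p T = ψ b.toBasis := by
    rw [frameDet, hψ, AlternatingMap.compLinearMap_apply]
    congr 1
    funext i
    simpa [hb] using (frameMap_single T i).symm
  rw [h1, h2, ψ.eq_smul_basis_det b.toBasis]
  simp only [AlternatingMap.smul_apply, smul_eq_mul, Module.Basis.det_comp, Module.Basis.det_self,
    mul_one, mul_pow, sq_det_eq_one_of_involutive V hV]

lemma sum_norm_sq_map_orthonormalBasis {n d : ℕ}
    (L : EuclideanSpace ℝ (Fin n) →ₗ[ℝ] EuclideanSpace ℝ (Fin d))
    (b : OrthonormalBasis (Fin n) ℝ (EuclideanSpace ℝ (Fin n))) :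
    ∑ i, ‖L (b i)‖ ^ 2 = ∑ a, ‖L.adjoint (EuclideanSpace.basisFun (Fin d) ℝ a)‖ ^ 2 := by
  have h1 : ∀ i, ‖L (b i)‖ ^ 2
      = ∑ a, ‖inner ℝ (EuclideanSpace.basisFun (Fin d) ℝ a) (L (b i))‖ ^ 2 := fun i =>
    ((EuclideanSpace.basisFun (Fin d) ℝ).sum_sq_norm_inner_right _).symm
  simp_rw [h1]
  rw [Finset.sum_comm]
  refine Finset.sum_congr rfl fun a _ => ?_
  rw [← b.sum_sq_norm_inner_left]
  refine Finset.sum_congr rfl fun i _ => ?_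
  rw [LinearMap.adjoint_inner_left]

lemma sum_norm_sq_frameComp {n d : ℕ}
    (V : EuclideanSpace ℝ (Fin n) ≃ₗᵢ[ℝ] EuclideanSpace ℝ (Fin n))
    (T : Fin n → EuclideanSpace ℝ (Fin d)) :
    ∑ i, ‖frameComp (V.toLinearEquiv : EuclideanSpace ℝ (Fin n) →ₗ[ℝ] _) T i‖ ^ 2
      = ∑ i, ‖T i‖ ^ 2 := by
  have h1 := sum_norm_sq_map_orthonormalBasis (frameMap T) (EuclideanSpace.basisFun (Fin n) ℝ)
  have h2 := sum_norm_sq_map_orthonormalBasis (frameMap T)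
    ((EuclideanSpace.basisFun (Fin n) ℝ).map V)
  simp_rw [frameMap_single] at h1
  rw [h1, ← h2]
  simp [frameComp]

lemma measurePreserving_frameComp {n d : ℕ}
    (V : EuclideanSpace ℝ (Fin n) →ₗ[ℝ] EuclideanSpace ℝ (Fin n)) (hV : ∀ y, V (V y) = y) :
    MeasurePreserving (frameComp (d := d) V) := by
  have hdet := sq_det_eq_one_of_involutive (frameComp (d := d) V) (frameComp_involutive V hV)
  refine ⟨(LinearMap.continuous_of_finiteDimensional _).measurable, ?_⟩
  have h0 : LinearMap.det (frameComp (d := d) V) ≠ 0 := by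
    intro h; simp [h] at hdet
  rw [Measure.map_linearMap_addHaar_eq_smul_addHaar _ h0]
  have habs : |LinearMap.det (frameComp (d := d) V)| = 1 :=
    by
    rw [← sq_abs] at hdet
    exact (pow_eq_one_iff_of_nonneg (abs_nonneg _) two_ne_zero).1 hdet
  rw [abs_inv, habs]
  simp

/-- Two vectors of equal norm are swapped by an isometric involution fixing every vector orthogonal
to both. -/
lemma exists_involutive_isometry_map {F : Type*} [NormedAddCommGroup F] [InnerProductSpace ℝ F]
    (u w : F) (h : ‖u‖ = ‖w‖) :
    ∃ U : F ≃ₗᵢ[ℝ] F, (∀ x, U (U x) = x) ∧ U u = w ∧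
      ∀ z, inner ℝ u z = 0 → inner ℝ w z = 0 → U z = z := by
  refine ⟨(Submodule.span ℝ {u - w})ᗮ.reflection, fun x => Submodule.reflection_reflection _ x,
    Submodule.reflection_sub h, fun z hu hw => ?_⟩
  refine (Submodule.reflection_eq_self_iff z).2 ?_
  rw [Submodule.mem_orthogonal_singleton_iff_inner_right, inner_sub_left, hu, hw, sub_zero]

/-- The Gaussian average of `det (p, x, S) ^ (2 * k)` over the frames `S`. -/
def gaussMoment {m : ℕ} (k : ℕ) (p x : EuclideanSpace ℝ (Fin (m + 1 + 1))) : ℝ≥0∞ :=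
  ∫⁻ S : Fin m → EuclideanSpace ℝ (Fin (m + 1 + 1)),
    ENNReal.ofReal (Real.exp (-∑ i, ‖S i‖ ^ 2) * (frameDet p (Fin.cons x S) ^ 2) ^ k)

lemma continuous_frameDet_cons {m : ℕ} (p x : EuclideanSpace ℝ (Fin (m + 1 + 1))) :
    Continuous fun S : Fin m → EuclideanSpace ℝ (Fin (m + 1 + 1)) => frameDet p (Fin.cons x S) := by
  simp only [frameDet_eq, Module.Basis.det_apply]
  refine Continuous.matrix_det (continuous_matrix fun i j => ?_)
  simp only [Module.Basis.toMatrix_apply]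
  refine Fin.cases ?_ (fun k => ?_) j
  · simpa using continuous_const
  · refine Fin.cases ?_ (fun l => ?_) k
    · simpa using continuous_const
    · simp only [Fin.cons_succ]
      simp; fun_prop

lemma gaussMoment_map {m : ℕ} (k : ℕ)
    (U : EuclideanSpace ℝ (Fin (m + 1 + 1)) ≃ₗᵢ[ℝ] EuclideanSpace ℝ (Fin (m + 1 + 1)))
    (hU : ∀ x, U (U x) = x) (p x : EuclideanSpace ℝ (Fin (m + 1 + 1))) :
    gaussMoment k (U p) (U x) = gaussMoment k p x := by
  have hmp : MeasurePreserving
      (fun (S : Fin m → EuclideanSpace ℝ (Fin (m + 1 + 1))) i => U (S i)) :=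
    volume_preserving_pi fun _ => U.measurePreserving
  have hcont := continuous_frameDet_cons (U p) (U x)
  rw [gaussMoment, ← hmp.lintegral_comp (by fun_prop), gaussMoment]
  refine lintegral_congr fun S => ?_
  have h : (Fin.cons (U x) (fun i => U (S i)) : Fin (m + 1) → EuclideanSpace ℝ (Fin (m + 1 + 1)))
      = fun i => U ((Fin.cons x S : Fin (m + 1) → EuclideanSpace ℝ (Fin (m + 1 + 1))) i) := by
    funext i
    refine Fin.cases ?_ (fun j => ?_) i <;> simp
  rw [h]
  have := frameDet_map_sq (U.toLinearEquiv : EuclideanSpace ℝ (Fin (m + 1 + 1)) →ₗ[ℝ] _) hU p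
    (Fin.cons x S)
  simp only [LinearEquiv.coe_coe, LinearIsometryEquiv.coe_toLinearEquiv] at this
  simp only [LinearIsometryEquiv.norm_map, this]

lemma gaussMoment_smul {m : ℕ} (k : ℕ) (a b : ℝ) (p x : EuclideanSpace ℝ (Fin (m + 1 + 1))) :
    gaussMoment k (a • p) (b • x) = gaussMoment k p x * ENNReal.ofReal (((a * b) ^ 2) ^ k) := by
  have hcont := continuous_frameDet_cons p x
  rw [gaussMoment, gaussMoment, ← lintegral_mul_const _ (by fun_prop)]
  refine lintegral_congr fun S => ?_
  rw [frameDet_smul_left, frameDet_cons_smul, ← ENNReal.ofReal_mul (by positivity)]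
  congr 1
  ring

lemma gaussMoment_add_smul {m : ℕ} (k : ℕ) (c : ℝ) (p x : EuclideanSpace ℝ (Fin (m + 1 + 1))) :
    gaussMoment k (p + c • x) x = gaussMoment k p x := by
  simp only [gaussMoment, frameDet_add_smul]

lemma gaussMoment_eq_of_orthonormal {m : ℕ} (k : ℕ) {p x q y : EuclideanSpace ℝ (Fin (m + 1 + 1))}
    (hp : ‖p‖ = 1) (hx : ‖x‖ = 1) (hpx : inner ℝ p x = 0)
    (hq : ‖q‖ = 1) (hy : ‖y‖ = 1) (hqy : inner ℝ q y = 0) :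
    gaussMoment k p x = gaussMoment k q y := by
  obtain ⟨U, hU, hUx, -⟩ := exists_involutive_isometry_map x y (hx.trans hy.symm)
  have hUp : ‖U p‖ = 1 := by simp [hp]
  obtain ⟨V, hV, hVp, hVz⟩ := exists_involutive_isometry_map (U p) q (hUp.trans hq.symm)
  have h1 : inner ℝ (U p) y = 0 := by rw [← hUx, U.inner_map_map, hpx]
  have h2 : V y = y := hVz y h1 hqy
  rw [← gaussMoment_map k U hU p x, hUx, ← gaussMoment_map k V hV, hVp, h2]

/-- The value of `gaussMoment` on an orthonormal pair. -/
def gaussConst (m k : ℕ) : ℝ≥0∞ :=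
  gaussMoment (m := m) k (EuclideanSpace.single 0 1) (EuclideanSpace.single 1 1)

lemma gaussMoment_eq {m k : ℕ} (hk : k ≠ 0) {p : EuclideanSpace ℝ (Fin (m + 1 + 1))} (hp : ‖p‖ = 1)
    (x : EuclideanSpace ℝ (Fin (m + 1 + 1))) :
    gaussMoment k p x = gaussConst m k * ENNReal.ofReal ((‖x‖ ^ 2 - inner ℝ x p ^ 2) ^ k) := by
  rcases eq_or_ne x 0 with rfl | hx
  · have := gaussMoment_smul k 1 0 p (0 : EuclideanSpace ℝ (Fin (m + 1 + 1)))
    simpa [hk] using this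
  have hx' : ‖x‖ ≠ 0 := norm_ne_zero_iff.2 hx
  set v := ‖x‖⁻¹ • x with hv
  have hvn : ‖v‖ = 1 := by simp [hv, norm_smul, hx']
  have hxv : x = ‖x‖ • v := by simp [hv, smul_smul, hx']
  set q := p - inner ℝ v p • v with hq
  have hqv : inner ℝ q v = 0 := by
    rw [hq, inner_sub_left, real_inner_smul_left, real_inner_self_eq_norm_sq, hvn,
      real_inner_comm]
    ring
  have hpq : gaussMoment k p x = gaussMoment k q x := by
    have : p = q + (inner ℝ v p * ‖x‖⁻¹) • x := by
      rw [hq, mul_smul, ← hv]; abel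
    rw [this, gaussMoment_add_smul]
  have hqn : ‖q‖ ^ 2 = 1 - inner ℝ v p ^ 2 := by
    have h1 : p = q + inner ℝ v p • v := by rw [hq]; abel
    have h2 : ‖p‖ ^ 2 = ‖q‖ ^ 2 + inner ℝ v p ^ 2 := by
      conv_lhs => rw [h1]
      rw [norm_add_sq_real, real_inner_smul_right, hqv, norm_smul, hvn]
      simp
    rw [hp] at h2
    linarith
  have hval : ‖x‖ ^ 2 - inner ℝ x p ^ 2 = (‖q‖ * ‖x‖) ^ 2 := by
    have : inner ℝ x p = ‖x‖ * inner ℝ v p := by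
      conv_lhs => rw [hxv]
      rw [real_inner_smul_left]
    rw [this, mul_pow ‖q‖, hqn]; ring
  rw [hpq, hval]
  rcases eq_or_ne q 0 with h0 | h0
  · rw [h0]
    have := gaussMoment_smul k 0 1 (0 : EuclideanSpace ℝ (Fin (m + 1 + 1))) x
    simpa [hk] using this
  have h0' : ‖q‖ ≠ 0 := norm_ne_zero_iff.2 h0
  have hqu : q = ‖q‖ • (‖q‖⁻¹ • q) := by simp [smul_smul, h0']
  have : gaussMoment k q x = gaussMoment k (‖q‖ • (‖q‖⁻¹ • q)) (‖x‖ • v) := by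
    rw [← hqu, ← hxv]
  rw [this, gaussMoment_smul]
  congr 1
  refine gaussMoment_eq_of_orthonormal k (by simp [norm_smul, h0']) hvn ?_ (by simp) (by simp) ?_
  · rw [real_inner_smul_left, hqv, mul_zero]
  · simp [EuclideanSpace.inner_single_left]

lemma gaussConst_ne_zero (m k : ℕ) : gaussConst m k ≠ 0 := by
  have hcont := continuous_frameDet_cons (m := m) (EuclideanSpace.single 0 1)
    (EuclideanSpace.single 1 1)
  set g : (Fin m → EuclideanSpace ℝ (Fin (m + 1 + 1))) → ℝ := fun S =>
    Real.exp (-∑ i, ‖S i‖ ^ 2) *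
      (frameDet (EuclideanSpace.single 0 1) (Fin.cons (EuclideanSpace.single 1 1) S) ^ 2) ^ k
    with hg
  have hgc : Continuous g := by fun_prop
  have hpos : 0 < g fun i => EuclideanSpace.single i.succ.succ 1 := by
    have : (Fin.cons (EuclideanSpace.single 0 1)
        (Fin.cons (EuclideanSpace.single 1 1) fun i : Fin m => EuclideanSpace.single i.succ.succ 1)
        : Fin (m + 1 + 1) → EuclideanSpace ℝ (Fin (m + 1 + 1)))
        = (EuclideanSpace.basisFun (Fin (m + 1 + 1)) ℝ).toBasis := by
      funext i
      refine Fin.cases (by simp) (fun j => ?_) i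
      refine Fin.cases (by simp) (fun l => by simp) j
    simp only [hg]
    rw [frameDet_eq, this, Module.Basis.det_self]
    positivity
  have hopen : IsOpen {S | 0 < g S} := isOpen_lt continuous_const hgc
  have hmeas := (hopen.measure_pos volume ⟨_, hpos⟩).ne'
  have hsupp : Function.support (fun S => ENNReal.ofReal (g S)) = {S | 0 < g S} := by
    ext S; simp
  rw [gaussConst, gaussMoment]
  refine ((lintegral_pos_iff_support (f := fun S => ENNReal.ofReal (g S)) (by fun_prop)).2 ?_).ne'
  rw [hsupp]
  exact pos_iff_ne_zero.2 hmeas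

lemma gaussConst_ne_top (m k : ℕ) : gaussConst m k ≠ ∞ := by
  have hcont := continuous_frameDet_cons (m := m) (EuclideanSpace.single 0 1)
    (EuclideanSpace.single 1 1)
  have hint : Integrable fun t : EuclideanSpace ℝ (Fin (m + 1 + 1)) =>
      Real.exp (-‖t‖ ^ 2) * (‖t‖ ^ 2) ^ k := by
    have := integrable_fun_norm_addHaar (volume : Measure (EuclideanSpace ℝ (Fin (m + 1 + 1))))
      (f := fun r : ℝ => Real.exp (-r ^ 2) * (r ^ 2) ^ k)
    rw [this]
    have h := integrableOn_rpow_mul_exp_neg_mul_sq (b := 1) one_pos (s := ((m + 1 + 2 * k : ℕ) : ℝ))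
      (by have : (0 : ℝ) ≤ ((m + 1 + 2 * k : ℕ) : ℝ) := by positivity
          linarith)
    refine h.congr_fun (fun r _ => ?_) measurableSet_Ioi
    simp only [Real.rpow_natCast, finrank_euclideanSpace_fin, smul_eq_mul]
    rw [show m + 1 + 1 - 1 = m + 1 by omega]
    ring_nf
  have hprod := Integrable.fintype_prod (ι := Fin m) (𝕜 := ℝ)
    (f := fun _ (t : EuclideanSpace ℝ (Fin (m + 1 + 1))) => Real.exp (-‖t‖ ^ 2) * (‖t‖ ^ 2) ^ k)
    (μ := fun _ => volume) (fun _ => hint)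
  have hle : gaussConst m k ≤ ∫⁻ S : Fin m → EuclideanSpace ℝ (Fin (m + 1 + 1)),
      ENNReal.ofReal (∏ i, (Real.exp (-‖S i‖ ^ 2) * (‖S i‖ ^ 2) ^ k)) := by
    refine lintegral_mono fun S => ENNReal.ofReal_le_ofReal ?_
    rw [Finset.prod_mul_distrib, ← Real.exp_sum, Finset.sum_neg_distrib, Finset.prod_pow,
      Finset.prod_pow]
    gcongr ?_ * ?_
    refine pow_le_pow_left₀ (sq_nonneg _) ?_ k
    rw [← sq_abs]
    exact pow_le_pow_left₀ (abs_nonneg _)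
      (abs_frameDet_cons_le _ _ (by simp) (by simp) S) 2
  exact (hle.trans_lt hprod.lintegral_lt_top).ne

instance isAddHaarMeasure_hausdorffMeasure_euclideanSpace (n : ℕ) :
    Measure.IsAddHaarMeasure (μH[(n : ℝ)] : Measure (EuclideanSpace ℝ (Fin n))) := by
  simpa using MeasureTheory.isAddHaarMeasure_hausdorffMeasure (E := EuclideanSpace ℝ (Fin n))

lemma hausdorffMeasure_inter_range {n : ℕ} {F : Type*} [NormedAddCommGroup F]
    [InnerProductSpace ℝ F] [MeasurableSpace F] [BorelSpace F] (B : Set F)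
    (ψ : EuclideanSpace ℝ (Fin n) →ₗᵢ[ℝ] F)
    (A : EuclideanSpace ℝ (Fin n) ≃ₗ[ℝ] EuclideanSpace ℝ (Fin n)) :
    μH[(n : ℝ)] (B ∩ Set.range ψ) =
      ENNReal.ofReal |LinearMap.det (A : EuclideanSpace ℝ (Fin n) →ₗ[ℝ] _)| *
        μH[(n : ℝ)] ((fun y => ψ (A y)) ⁻¹' B) := by
  rw [← Set.image_preimage_eq_inter_range,
    ψ.isometry.hausdorffMeasure_image (Or.inl (Nat.cast_nonneg n)),
    ← Measure.addHaar_image_linearMap]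
  congr 1
  change _ = A '' (A ⁻¹' (ψ ⁻¹' B))
  rw [Set.image_preimage_eq _ A.surjective]

/-- If all central hyperplane sections of `B` have the same measure, then the parameter volume of
a section depends only on the Gram matrix of the frame. -/
lemma hausdorffMeasure_frameMap_preimage_map {n : ℕ} {B : Set (EuclideanSpace ℝ (Fin (n + 1)))}
    {c : ℝ≥0∞}
    (hsec : ∀ H : Submodule ℝ (EuclideanSpace ℝ (Fin (n + 1))), Module.finrank ℝ H = n →
      μH[(n : ℝ)] (B ∩ (H : Set (EuclideanSpace ℝ (Fin (n + 1))))) = c)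
    {T : Fin n → EuclideanSpace ℝ (Fin (n + 1))} (hT : LinearIndependent ℝ T)
    (U : EuclideanSpace ℝ (Fin (n + 1)) ≃ₗᵢ[ℝ] EuclideanSpace ℝ (Fin (n + 1))) :
    μH[(n : ℝ)] (frameMap (fun i => U (T i)) ⁻¹' B) = μH[(n : ℝ)] (frameMap T ⁻¹' B) := by
  have hinj : Function.Injective (frameMap T) := by
    rw [← LinearMap.ker_eq_bot, LinearMap.ker_eq_bot']
    intro y hy
    rw [frameMap_apply] at hy
    ext i
    exact Fintype.linearIndependent_iff.1 hT _ hy i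
  set H := LinearMap.range (frameMap T) with hH
  have hfin : Module.finrank ℝ H = n := by
    rw [hH, LinearMap.finrank_range_of_inj hinj, finrank_euclideanSpace_fin]
  let φ : EuclideanSpace ℝ (Fin n) ≃ₗᵢ[ℝ] H :=
    ((stdOrthonormalBasis ℝ H).reindex (finCongr hfin)).repr.symm
  let A : EuclideanSpace ℝ (Fin n) ≃ₗ[ℝ] EuclideanSpace ℝ (Fin n) :=
    (LinearEquiv.ofInjective (frameMap T) hinj).trans φ.symm.toLinearEquiv
  have hA : ∀ y, ((φ (A y) : H) : EuclideanSpace ℝ (Fin (n + 1))) = frameMap T y := by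
    intro y
    simp [A]
  have hdet : ENNReal.ofReal |LinearMap.det (A : EuclideanSpace ℝ (Fin n) →ₗ[ℝ] _)| ≠ 0 := by
    simpa using A.isUnit_det'.ne_zero
  have key : ∀ W : EuclideanSpace ℝ (Fin (n + 1)) ≃ₗᵢ[ℝ] EuclideanSpace ℝ (Fin (n + 1)),
      c = ENNReal.ofReal |LinearMap.det (A : EuclideanSpace ℝ (Fin n) →ₗ[ℝ] _)| *
        μH[(n : ℝ)] (frameMap (fun i => W (T i)) ⁻¹' B) := by
    intro W
    let ψ : EuclideanSpace ℝ (Fin n) →ₗᵢ[ℝ] EuclideanSpace ℝ (Fin (n + 1)) :=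
      W.toLinearIsometry.comp (H.subtypeₗᵢ.comp φ.toLinearIsometry)
    have h1 := hausdorffMeasure_inter_range B ψ A
    have h2 : (fun y => ψ (A y)) = frameMap (fun i => W (T i)) := by
      funext y
      have : ψ (A y) = W (φ (A y) : H) := rfl
      rw [this, hA, frameMap_apply, frameMap_apply]
      simp
    have h3 := hsec (LinearMap.range ψ.toLinearMap) (by
      rw [LinearMap.finrank_range_of_inj ψ.injective, finrank_euclideanSpace_fin])
    rw [h2] at h1
    rw [← h1, ← h3]
    rfl
  have h := (key U).symm.trans (key (LinearIsometryEquiv.refl ℝ _))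
  exact (ENNReal.mul_right_inj hdet ENNReal.ofReal_ne_top).1 h

/-- The Gaussian weight times a power of the determinant. -/
def frameWeight {n : ℕ} (k : ℕ) (p : EuclideanSpace ℝ (Fin (n + 1)))
    (T : Fin n → EuclideanSpace ℝ (Fin (n + 1))) : ℝ≥0∞ :=
  ENNReal.ofReal (Real.exp (-∑ i, ‖T i‖ ^ 2) * (frameDet p T ^ 2) ^ k)

lemma measurable_frameWeight {n : ℕ} (k : ℕ) (p : EuclideanSpace ℝ (Fin (n + 1))) :
    Measurable (frameWeight k p) := by
  have := continuous_frameDet p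
  unfold frameWeight
  fun_prop

lemma continuous_frameMap_uncurry {n d : ℕ} :
    Continuous fun q : (Fin n → EuclideanSpace ℝ (Fin d)) × EuclideanSpace ℝ (Fin n) =>
      frameMap q.1 q.2 := by
  simp only [frameMap_apply]
  fun_prop

/-- The average over Gaussian frames of the parameter volume of the section of `B`, weighted with
a power of the determinant. -/
def frameIntegral {n : ℕ} (B : Set (EuclideanSpace ℝ (Fin (n + 1)))) (k : ℕ)
    (p : EuclideanSpace ℝ (Fin (n + 1))) : ℝ≥0∞ :=
  ∫⁻ T : Fin n → EuclideanSpace ℝ (Fin (n + 1)),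
    frameWeight k p T * μH[(n : ℝ)] (frameMap T ⁻¹' B)

lemma measurable_hausdorffMeasure_frameMap_preimage {n : ℕ}
    {B : Set (EuclideanSpace ℝ (Fin (n + 1)))} (hB : MeasurableSet B) :
    Measurable fun T : Fin n → EuclideanSpace ℝ (Fin (n + 1)) =>
      μH[(n : ℝ)] (frameMap T ⁻¹' B) :=
  measurable_measure_prodMk_left (continuous_frameMap_uncurry.measurable hB)

lemma frameIntegral_eq_of_norm_eq {n : ℕ} {B : Set (EuclideanSpace ℝ (Fin (n + 1)))}
    (hB : MeasurableSet B) {c : ℝ≥0∞}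
    (hsec : ∀ H : Submodule ℝ (EuclideanSpace ℝ (Fin (n + 1))), Module.finrank ℝ H = n →
      μH[(n : ℝ)] (B ∩ (H : Set (EuclideanSpace ℝ (Fin (n + 1))))) = c)
    {k : ℕ} (hk : k ≠ 0) {p q : EuclideanSpace ℝ (Fin (n + 1))} (hpq : ‖p‖ = ‖q‖) :
    frameIntegral B k p = frameIntegral B k q := by
  obtain ⟨U, hU, hUp, -⟩ := exists_involutive_isometry_map p q hpq
  have hmp : MeasurePreserving
      (fun (T : Fin n → EuclideanSpace ℝ (Fin (n + 1))) i => U (T i)) :=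
    volume_preserving_pi fun _ => U.measurePreserving
  have hmeas : Measurable fun T : Fin n → EuclideanSpace ℝ (Fin (n + 1)) =>
      frameWeight k q T * μH[(n : ℝ)] (frameMap T ⁻¹' B) :=
    (measurable_frameWeight k q).mul (measurable_hausdorffMeasure_frameMap_preimage hB)
  rw [frameIntegral, frameIntegral, ← hmp.lintegral_comp hmeas]
  refine lintegral_congr fun T => ?_
  have hw : frameWeight k q (fun i => U (T i)) = frameWeight k p T := by
    have := frameDet_map_sq (U.toLinearEquiv : EuclideanSpace ℝ (Fin (n + 1)) →ₗ[ℝ] _) hU p T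
    simp only [LinearEquiv.coe_coe, LinearIsometryEquiv.coe_toLinearEquiv, hUp] at this
    simp only [frameWeight, LinearIsometryEquiv.norm_map, this]
  by_cases hT : LinearIndependent ℝ T
  · rw [hw, hausdorffMeasure_frameMap_preimage_map hsec hT U]
  · have h0 : frameWeight k p T = 0 := by
      simp [frameWeight, frameDet_eq_zero_of_not_linearIndependent p T hT, hk]
    rw [hw, h0, zero_mul, zero_mul]

lemma frameWeight_frameComp {n : ℕ} (k : ℕ)
    (V : EuclideanSpace ℝ (Fin n) ≃ₗᵢ[ℝ] EuclideanSpace ℝ (Fin n)) (hV : ∀ y, V (V y) = y)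
    (p : EuclideanSpace ℝ (Fin (n + 1))) (T : Fin n → EuclideanSpace ℝ (Fin (n + 1))) :
    frameWeight k p (frameComp (V.toLinearEquiv : EuclideanSpace ℝ (Fin n) →ₗ[ℝ] _) T)
      = frameWeight k p T := by
  rw [frameWeight, sum_norm_sq_frameComp, frameDet_frameComp_sq _ hV, frameWeight]

lemma lintegral_frameWeight_mul_comp_frameMap {m k : ℕ} (p : EuclideanSpace ℝ (Fin (m + 1 + 1)))
    {g : EuclideanSpace ℝ (Fin (m + 1 + 1)) → ℝ≥0∞} (hg : Measurable g)
    (y : EuclideanSpace ℝ (Fin (m + 1))) :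
    ∫⁻ T, frameWeight k p T * g (frameMap T y) = ∫⁻ T, frameWeight k p T * g (‖y‖ • T 0) := by
  obtain ⟨V, hV, hVy, -⟩ := exists_involutive_isometry_map y
    (‖y‖ • EuclideanSpace.basisFun (Fin (m + 1)) ℝ 0) (by simp [norm_smul])
  have hmp := measurePreserving_frameComp (d := m + 1 + 1)
    (V.toLinearEquiv : EuclideanSpace ℝ (Fin (m + 1)) →ₗ[ℝ] _) hV
  have hc : Continuous fun T : Fin (m + 1) → EuclideanSpace ℝ (Fin (m + 1 + 1)) =>
      frameMap T y := by
    simp only [frameMap_apply]; fun_prop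
  have hmeas : Measurable fun T : Fin (m + 1) → EuclideanSpace ℝ (Fin (m + 1 + 1)) =>
      frameWeight k p T * g (frameMap T y) :=
    (measurable_frameWeight k p).mul (hg.comp hc.measurable)
  rw [← hmp.lintegral_comp hmeas]
  refine lintegral_congr fun T => ?_
  rw [frameWeight_frameComp k V hV, frameMap_frameComp, LinearMap.comp_apply]
  simp only [LinearEquiv.coe_coe, LinearIsometryEquiv.coe_toLinearEquiv, hVy]
  rw [map_smul, frameMap_single]

lemma frameWeight_cons {m : ℕ} (k : ℕ) (p x : EuclideanSpace ℝ (Fin (m + 1 + 1)))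
    (S : Fin m → EuclideanSpace ℝ (Fin (m + 1 + 1))) :
    frameWeight k p (Fin.cons x S) = ENNReal.ofReal (Real.exp (-‖x‖ ^ 2)) *
      ENNReal.ofReal (Real.exp (-∑ i, ‖S i‖ ^ 2) * (frameDet p (Fin.cons x S) ^ 2) ^ k) := by
  rw [frameWeight, ← ENNReal.ofReal_mul (by positivity), Fin.sum_univ_succ, neg_add, Real.exp_add,
    Fin.cons_zero, mul_assoc]
  simp only [Fin.cons_succ]

lemma lintegral_frameWeight_mul_head {m k : ℕ} (p : EuclideanSpace ℝ (Fin (m + 1 + 1)))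
    {g : EuclideanSpace ℝ (Fin (m + 1 + 1)) → ℝ≥0∞} (hg : Measurable g) :
    ∫⁻ T : Fin (m + 1) → EuclideanSpace ℝ (Fin (m + 1 + 1)), frameWeight k p T * g (T 0)
      = ∫⁻ x, ENNReal.ofReal (Real.exp (-‖x‖ ^ 2)) * gaussMoment k p x * g x := by
  have hmp := (measurePreserving_piFinSuccAbove
    (fun _ : Fin (m + 1) => (volume : Measure (EuclideanSpace ℝ (Fin (m + 1 + 1))))) 0).symm
  have hmeas : Measurable fun T : Fin (m + 1) → EuclideanSpace ℝ (Fin (m + 1 + 1)) =>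
      frameWeight k p T * g (T 0) :=
    (measurable_frameWeight k p).mul (hg.comp (measurable_pi_apply 0))
  rw [volume_pi, ← hmp.lintegral_comp hmeas,
    lintegral_prod _ (by exact (hmeas.comp hmp.measurable).aemeasurable)]
  refine lintegral_congr fun x => ?_
  have hcons : ∀ S : Fin m → EuclideanSpace ℝ (Fin (m + 1 + 1)),
      (MeasurableEquiv.piFinSuccAbove
        (fun _ : Fin (m + 1) => EuclideanSpace ℝ (Fin (m + 1 + 1))) 0).symm (x, S)
        = Fin.cons x S := fun S => by
    funext i
    refine Fin.cases ?_ (fun j => ?_) i <;> simp [MeasurableEquiv.piFinSuccAbove]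
  have hcont := continuous_frameDet_cons p x
  simp only [hcons, frameWeight_cons, Fin.cons_zero]
  rw [lintegral_mul_const _ (by fun_prop), lintegral_const_mul _ (by fun_prop)]
  rfl

lemma frameIntegral_eq_lintegral {m : ℕ} {B : Set (EuclideanSpace ℝ (Fin (m + 1 + 1)))}
    (hB : MeasurableSet B) (k : ℕ) (p : EuclideanSpace ℝ (Fin (m + 1 + 1))) :
    frameIntegral B k p = ∫⁻ x, ENNReal.ofReal (Real.exp (-‖x‖ ^ 2)) * gaussMoment k p x *
      μH[((m + 1 : ℕ) : ℝ)] {y : EuclideanSpace ℝ (Fin (m + 1)) | ‖y‖ • x ∈ B} := by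
  set g : EuclideanSpace ℝ (Fin (m + 1 + 1)) → ℝ≥0∞ := B.indicator 1 with hg
  have hgm : Measurable g := measurable_one.indicator hB
  have hc1 : Measurable fun q : (Fin (m + 1) → EuclideanSpace ℝ (Fin (m + 1 + 1))) ×
      EuclideanSpace ℝ (Fin (m + 1)) => frameWeight k p q.1 * g (frameMap q.1 q.2) :=
    ((measurable_frameWeight k p).comp measurable_fst).mul
      (hgm.comp continuous_frameMap_uncurry.measurable)
  have hc2 : Measurable fun q : (Fin (m + 1) → EuclideanSpace ℝ (Fin (m + 1 + 1))) ×
      EuclideanSpace ℝ (Fin (m + 1)) => frameWeight k p q.1 * g (‖q.2‖ • q.1 0) :=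
    ((measurable_frameWeight k p).comp measurable_fst).mul (hgm.comp (by fun_prop))
  have hind : ∀ f : EuclideanSpace ℝ (Fin (m + 1)) → EuclideanSpace ℝ (Fin (m + 1 + 1)),
      Measurable f → μH[((m + 1 : ℕ) : ℝ)] (f ⁻¹' B)
        = ∫⁻ y, g (f y) ∂(μH[((m + 1 : ℕ) : ℝ)]) := fun f hf => by
    rw [← lintegral_indicator_one (hf hB)]
    rfl
  have hM : Measurable fun x : EuclideanSpace ℝ (Fin (m + 1 + 1)) =>
      μH[((m + 1 : ℕ) : ℝ)] {y : EuclideanSpace ℝ (Fin (m + 1)) | ‖y‖ • x ∈ B} := by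
    have hc : Measurable fun q : EuclideanSpace ℝ (Fin (m + 1 + 1)) ×
        EuclideanSpace ℝ (Fin (m + 1)) => ‖q.2‖ • q.1 := by fun_prop
    exact measurable_measure_prodMk_left (hc hB)
  rw [← lintegral_frameWeight_mul_head p hM, frameIntegral]
  calc _ = ∫⁻ T : Fin (m + 1) → EuclideanSpace ℝ (Fin (m + 1 + 1)),
        ∫⁻ y, frameWeight k p T * g (frameMap T y) ∂(μH[((m + 1 : ℕ) : ℝ)]) := by
        refine lintegral_congr fun T => ?_
        have hm := (LinearMap.continuous_of_finiteDimensional (frameMap T)).measurable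
        rw [hind _ hm, lintegral_const_mul _ (by exact hgm.comp hm)]
    _ = ∫⁻ y, (∫⁻ T : Fin (m + 1) → EuclideanSpace ℝ (Fin (m + 1 + 1)),
        frameWeight k p T * g (frameMap T y)) ∂(μH[((m + 1 : ℕ) : ℝ)]) :=
        lintegral_lintegral_swap hc1.aemeasurable
    _ = ∫⁻ y, (∫⁻ T : Fin (m + 1) → EuclideanSpace ℝ (Fin (m + 1 + 1)),
        frameWeight k p T * g (‖y‖ • T 0)) ∂(μH[((m + 1 : ℕ) : ℝ)]) :=
        lintegral_congr fun y => lintegral_frameWeight_mul_comp_frameMap p hgm y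
    _ = ∫⁻ T : Fin (m + 1) → EuclideanSpace ℝ (Fin (m + 1 + 1)),
        ∫⁻ y, frameWeight k p T * g (‖y‖ • T 0) ∂(μH[((m + 1 : ℕ) : ℝ)]) :=
        (lintegral_lintegral_swap hc2.aemeasurable).symm
    _ = _ := by
        refine lintegral_congr fun T => ?_
        have hm : Measurable fun y : EuclideanSpace ℝ (Fin (m + 1)) => ‖y‖ • T 0 := by fun_prop
        rw [lintegral_const_mul _ (by exact hgm.comp hm), ← hind _ hm]
        rfl

lemma lintegral_eq_lintegral_sphere_mul {F : Type*} [NormedAddCommGroup F] [NormedSpace ℝ F]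
    [FiniteDimensional ℝ F] [Nontrivial F] [MeasurableSpace F] [BorelSpace F] (μ : Measure F)
    [μ.IsAddHaarMeasure] {f : F → ℝ≥0∞} {G : sphere (0 : F) 1 → ℝ≥0∞} {h : ℝ → ℝ≥0∞}
    (hG : Measurable G) (hh : Measurable h)
    (hf : ∀ (θ : sphere (0 : F) 1) (r : ℝ), 0 < r → f (r • (θ : F)) = G θ * h r) :
    ∫⁻ x, f x ∂μ = (∫⁻ θ, G θ ∂μ.toSphere) *
      ∫⁻ r in Set.Ioi (0 : ℝ), ENNReal.ofReal (r ^ (Module.finrank ℝ F - 1)) * h r := by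
  have hm : Measurable fun r : Set.Ioi (0 : ℝ) => h r := hh.comp measurable_subtype_coe
  calc ∫⁻ x, f x ∂μ = ∫⁻ x : ({0}ᶜ : Set F), f x ∂(μ.comap (↑)) := by
        rw [lintegral_subtype_comap (measurableSet_singleton _).compl f, restrict_compl_singleton]
    _ = ∫⁻ z, G z.1 * h z.2 ∂μ.toSphere.prod (.volumeIoiPow (Module.finrank ℝ F - 1)) := by
        rw [← μ.measurePreserving_homeomorphUnitSphereProd.lintegral_comp_emb
          (Homeomorph.measurableEmbedding _)]
        refine lintegral_congr fun x => ?_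
        have hx : (0 : ℝ) < ((homeomorphUnitSphereProd F x).2 : ℝ) :=
          (homeomorphUnitSphereProd F x).2.2
        rw [← hf _ _ hx]
        have := congrArg Subtype.val ((homeomorphUnitSphereProd F).symm_apply_apply x)
        rw [homeomorphUnitSphereProd_symm_apply_coe] at this
        rw [this]
    _ = (∫⁻ θ, G θ ∂μ.toSphere) *
          ∫⁻ r, h r ∂(Measure.volumeIoiPow (Module.finrank ℝ F - 1)) :=
        lintegral_prod_mul hG.aemeasurable hm.aemeasurable
    _ = _ := by
        congr 1
        rw [Measure.volumeIoiPow, lintegral_withDensity_eq_lintegral_mul _ (by fun_prop) hm]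
        exact lintegral_subtype_comap measurableSet_Ioi
          fun r : ℝ => ENNReal.ofReal (r ^ (Module.finrank ℝ F - 1)) * h r

/-- The Gaussian radial moment of order `2 * k`. -/
def radialMoment (k : ℕ) : ℝ≥0∞ :=
  ∫⁻ r in Set.Ioi (0 : ℝ), ENNReal.ofReal (Real.exp (-r ^ 2) * (r ^ 2) ^ k)

lemma radialMoment_ne_top (k : ℕ) : radialMoment k ≠ ∞ := by
  have h := integrableOn_rpow_mul_exp_neg_mul_sq (b := 1) one_pos (s := ((2 * k : ℕ) : ℝ))
    (by have : (0 : ℝ) ≤ ((2 * k : ℕ) : ℝ) := by positivity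
        linarith)
  have h2 : IntegrableOn (fun r : ℝ => Real.exp (-r ^ 2) * (r ^ 2) ^ k) (Set.Ioi 0) := by
    refine h.congr_fun (fun r _ => ?_) measurableSet_Ioi
    simp only [Real.rpow_natCast]
    ring_nf
  exact (Integrable.lintegral_lt_top h2).ne

lemma radialMoment_ne_zero (k : ℕ) : radialMoment k ≠ 0 := by
  rw [radialMoment]
  refine ((setLIntegral_pos_iff (by fun_prop)).2 ?_).ne'
  have : Set.Ioi (0 : ℝ) ⊆ Function.support
      fun r : ℝ => ENNReal.ofReal (Real.exp (-r ^ 2) * (r ^ 2) ^ k) := by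
    intro r (hr : 0 < r)
    have : 0 < Real.exp (-r ^ 2) * (r ^ 2) ^ k := by positivity
    simpa using this
  rw [Set.inter_eq_self_of_subset_right this]
  simp

variable {m : ℕ} {B : Set (EuclideanSpace ℝ (Fin (m + 1 + 1)))}

lemma gauge_pos_of_isCompact {F : Type*} [NormedAddCommGroup F] [NormedSpace ℝ F] {B : Set F}
    (hBc : IsCompact B) (hB0 : (0 : F) ∈ interior B) {x : F} (hx : x ≠ 0) : 0 < gauge B x :=
  (gauge_pos (absorbent_nhds_zero (mem_interior_iff_mem_nhds.1 hB0))
    (NormedSpace.isVonNBounded_of_isBounded ℝ hBc.isBounded)).2 hx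

lemma mem_iff_gauge_le_one {F : Type*} [NormedAddCommGroup F] [NormedSpace ℝ F] {B : Set F}
    (hBc : IsCompact B) (hBconv : Convex ℝ B) (hB0 : (0 : F) ∈ interior B) {x : F} :
    x ∈ B ↔ gauge B x ≤ 1 := by
  rw [gauge_le_one_iff_mem_closure hBconv (mem_interior_iff_mem_nhds.1 hB0),
    hBc.isClosed.closure_eq]

lemma hausdorffMeasure_norm_smul_mem {F : Type*} [NormedAddCommGroup F] [NormedSpace ℝ F]
    {B : Set F} (hBc : IsCompact B) (hBconv : Convex ℝ B) (hB0 : (0 : F) ∈ interior B)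
    {d : ℕ} {x : F} (hx : x ≠ 0) :
    μH[(d : ℝ)] {y : EuclideanSpace ℝ (Fin d) | ‖y‖ • x ∈ B} =
      ENNReal.ofReal ((gauge B x)⁻¹ ^ d) *
        μH[(d : ℝ)] (ball (0 : EuclideanSpace ℝ (Fin d)) 1) := by
  have hg := gauge_pos_of_isCompact hBc hB0 hx
  have : {y : EuclideanSpace ℝ (Fin d) | ‖y‖ • x ∈ B} = closedBall 0 (gauge B x)⁻¹ := by
    ext y
    rw [Set.mem_ofPred_eq, mem_iff_gauge_le_one hBc hBconv hB0,
      gauge_smul_of_nonneg (norm_nonneg y), mem_closedBall_zero_iff, smul_eq_mul,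
      ← one_div, le_div_iff₀ hg]
  rw [this, Measure.addHaar_closedBall _ _ (inv_nonneg.2 hg.le), finrank_euclideanSpace_fin]

/-- The weighted spherical integral of the `(m + 1)`-st power of the radial function of `B`. -/
def sphereIntegral (B : Set (EuclideanSpace ℝ (Fin (m + 1 + 1)))) (k : ℕ)
    (p : EuclideanSpace ℝ (Fin (m + 1 + 1))) : ℝ :=
  ∫ θ : sphere (0 : EuclideanSpace ℝ (Fin (m + 1 + 1))) 1,
    (gauge B θ)⁻¹ ^ (m + 1) * (1 - inner ℝ (θ : EuclideanSpace ℝ (Fin (m + 1 + 1))) p ^ 2) ^ k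
    ∂(volume.toSphere)

lemma continuous_radial (hBc : IsCompact B) (hBconv : Convex ℝ B) (hB0 : 0 ∈ interior B) :
    Continuous fun θ : sphere (0 : EuclideanSpace ℝ (Fin (m + 1 + 1))) 1 =>
      (gauge B θ)⁻¹ ^ (m + 1) := by
  refine Continuous.pow (Continuous.inv₀ ?_ fun θ => ?_) _
  · exact (continuous_gauge hBconv (mem_interior_iff_mem_nhds.1 hB0)).comp continuous_subtype_val
  · exact (gauge_pos_of_isCompact hBc hB0 (ne_zero_of_mem_unit_sphere θ)).ne'

lemma inner_sq_le_one (θ : sphere (0 : EuclideanSpace ℝ (Fin (m + 1 + 1))) 1)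
    {p : EuclideanSpace ℝ (Fin (m + 1 + 1))} (hp : ‖p‖ = 1) :
    inner ℝ (θ : EuclideanSpace ℝ (Fin (m + 1 + 1))) p ^ 2 ≤ 1 := by
  have h := abs_real_inner_le_norm (θ : EuclideanSpace ℝ (Fin (m + 1 + 1))) p
  rw [norm_eq_of_mem_sphere, hp, one_mul] at h
  rw [← sq_abs]
  exact pow_le_one₀ (abs_nonneg _) h

lemma frameIntegral_eq_mul_lintegral_sphere (hBc : IsCompact B) (hBconv : Convex ℝ B)
    (hB0 : 0 ∈ interior B) {k : ℕ} (hk : k ≠ 0) {p : EuclideanSpace ℝ (Fin (m + 1 + 1))}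
    (hp : ‖p‖ = 1) :
    frameIntegral B k p = (gaussConst m k *
      μH[((m + 1 : ℕ) : ℝ)] (ball (0 : EuclideanSpace ℝ (Fin (m + 1))) 1) * radialMoment k) *
      ∫⁻ θ : sphere (0 : EuclideanSpace ℝ (Fin (m + 1 + 1))) 1,
        ENNReal.ofReal ((gauge B θ)⁻¹ ^ (m + 1) *
          (1 - inner ℝ (θ : EuclideanSpace ℝ (Fin (m + 1 + 1))) p ^ 2) ^ k)
        ∂(volume.toSphere) := by
  set V := μH[((m + 1 : ℕ) : ℝ)] (ball (0 : EuclideanSpace ℝ (Fin (m + 1))) 1)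
  set g : sphere (0 : EuclideanSpace ℝ (Fin (m + 1 + 1))) 1 → ℝ := fun θ =>
    (gauge B θ)⁻¹ ^ (m + 1) * (1 - inner ℝ (θ : EuclideanSpace ℝ (Fin (m + 1 + 1))) p ^ 2) ^ k
    with hg
  have hgc : Continuous g := (continuous_radial hBc hBconv hB0).mul (by fun_prop)
  have hgm : Measurable fun θ => ENNReal.ofReal (g θ) := by fun_prop
  rw [frameIntegral_eq_lintegral hBc.isClosed.measurableSet,
    lintegral_eq_lintegral_sphere_mul volume
      (G := fun θ => gaussConst m k * V * ENNReal.ofReal (g θ))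
      (h := fun r => ENNReal.ofReal (Real.exp (-r ^ 2) * (r ^ 2) ^ k * r⁻¹ ^ (m + 1)))
      (hgm.const_mul _) (by fun_prop), lintegral_const_mul _ hgm]
  · have hrad : ∫⁻ r in Set.Ioi (0 : ℝ),
        ENNReal.ofReal (r ^ (Module.finrank ℝ (EuclideanSpace ℝ (Fin (m + 1 + 1))) - 1)) *
          ENNReal.ofReal (Real.exp (-r ^ 2) * (r ^ 2) ^ k * r⁻¹ ^ (m + 1)) = radialMoment k := by
      refine setLIntegral_congr_fun measurableSet_Ioi fun r (hr : 0 < r) => ?_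
      simp only [finrank_euclideanSpace_fin, Nat.add_sub_cancel]
      rw [← ENNReal.ofReal_mul (by positivity)]
      congr 1
      field_simp
      rw [← mul_pow, mul_one_div_cancel hr.ne', one_pow]
    rw [hrad]
    ring
  · intro θ r hr
    have hθ : ‖(θ : EuclideanSpace ℝ (Fin (m + 1 + 1)))‖ = 1 := norm_eq_of_mem_sphere θ
    have hx : r • (θ : EuclideanSpace ℝ (Fin (m + 1 + 1))) ≠ 0 :=
      smul_ne_zero hr.ne' (ne_zero_of_mem_unit_sphere θ)
    have hgp := gauge_pos_of_isCompact hBc hB0 (ne_zero_of_mem_unit_sphere θ)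
    have h1 := inner_sq_le_one θ hp
    rw [gaussMoment_eq hk hp, hausdorffMeasure_norm_smul_mem hBc hBconv hB0 hx,
      gauge_smul_of_nonneg hr.le, norm_smul, hθ, real_inner_smul_left, Real.norm_of_nonneg hr.le,
      mul_one]
    have e1 : ENNReal.ofReal ((r ^ 2 - (r * inner ℝ (θ : EuclideanSpace ℝ (Fin (m + 1 + 1))) p) ^ 2)
        ^ k) = ENNReal.ofReal ((r ^ 2) ^ k) * ENNReal.ofReal
          ((1 - inner ℝ (θ : EuclideanSpace ℝ (Fin (m + 1 + 1))) p ^ 2) ^ k) := by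
      rw [← ENNReal.ofReal_mul (by positivity)]
      congr 1
      rw [← mul_pow]
      ring
    have e2 : ENNReal.ofReal ((r • gauge B (θ : EuclideanSpace ℝ (Fin (m + 1 + 1))))⁻¹ ^ (m + 1))
        = ENNReal.ofReal (r⁻¹ ^ (m + 1)) * ENNReal.ofReal ((gauge B θ)⁻¹ ^ (m + 1)) := by
      rw [← ENNReal.ofReal_mul (by positivity), smul_eq_mul, mul_inv, mul_pow]
    rw [e1, e2, hg]
    simp only
    rw [ENNReal.ofReal_mul (p := (gauge B _)⁻¹ ^ (m + 1)) (by positivity),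
      ENNReal.ofReal_mul (q := r⁻¹ ^ (m + 1)) (by positivity),
      ENNReal.ofReal_mul (p := Real.exp _) (by positivity)]
    ring

lemma sphereIntegral_eq_of_norm_eq_one (hBc : IsCompact B) (hBconv : Convex ℝ B)
    (hB0 : 0 ∈ interior B) {c : ℝ≥0∞}
    (hsec : ∀ H : Submodule ℝ (EuclideanSpace ℝ (Fin (m + 1 + 1))), Module.finrank ℝ H = m + 1 →
      μH[((m + 1 : ℕ) : ℝ)] (B ∩ (H : Set (EuclideanSpace ℝ (Fin (m + 1 + 1))))) = c)
    (k : ℕ) {p q : EuclideanSpace ℝ (Fin (m + 1 + 1))} (hp : ‖p‖ = 1) (hq : ‖q‖ = 1) :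
    sphereIntegral B k p = sphereIntegral B k q := by
  rcases eq_or_ne k 0 with rfl | hk
  · simp [sphereIntegral]
  have h := frameIntegral_eq_of_norm_eq hBc.isClosed.measurableSet hsec hk (hp.trans hq.symm)
  rw [frameIntegral_eq_mul_lintegral_sphere hBc hBconv hB0 hk hp,
    frameIntegral_eq_mul_lintegral_sphere hBc hBconv hB0 hk hq, ENNReal.mul_right_inj] at h
  · have key : ∀ w : EuclideanSpace ℝ (Fin (m + 1 + 1)), ‖w‖ = 1 → sphereIntegral B k w =
        (∫⁻ θ : sphere (0 : EuclideanSpace ℝ (Fin (m + 1 + 1))) 1,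
        ENNReal.ofReal ((gauge B θ)⁻¹ ^ (m + 1) *
          (1 - inner ℝ (θ : EuclideanSpace ℝ (Fin (m + 1 + 1))) w ^ 2) ^ k)
        ∂(volume.toSphere)).toReal := fun w hw => by
      refine integral_eq_lintegral_of_nonneg_ae (Filter.Eventually.of_forall fun θ => ?_) ?_
      · have h1 := sub_nonneg.2 (inner_sq_le_one θ hw)
        have h2 := gauge_nonneg (s := B) (θ : EuclideanSpace ℝ (Fin (m + 1 + 1)))
        simp only [Pi.zero_apply]
        positivity
      · exact ((continuous_radial hBc hBconv hB0).mul (by fun_prop)).aestronglyMeasurable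
    rw [key p hp, key q hq, h]
  · refine mul_ne_zero (mul_ne_zero (gaussConst_ne_zero m k) ?_) (radialMoment_ne_zero k)
    exact (measure_ball_pos _ _ one_pos).ne'
  · exact ENNReal.mul_ne_top (ENNReal.mul_ne_top (gaussConst_ne_top m k) measure_ball_lt_top.ne)
      (radialMoment_ne_top k)

/-- Powers of a function `c` with maximum value `1` concentrate on the set where `c = 1`. -/
lemma tendsto_integral_mul_pow_div {X : Type*} [TopologicalSpace X] [CompactSpace X]
    [MeasurableSpace X] [BorelSpace X] (σ : Measure X) [IsFiniteMeasure σ] [σ.IsOpenPosMeasure]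
    {f c : X → ℝ} (hf : Continuous f) (hc : Continuous c) (hc0 : ∀ x, 0 ≤ c x)
    (hc1 : ∀ x, c x ≤ 1) {v : ℝ} (hv : ∀ x, c x = 1 → f x = v) (hex : ∃ x, c x = 1) :
    Filter.Tendsto (fun k : ℕ => (∫ x, f x * c x ^ k ∂σ) / ∫ x, c x ^ k ∂σ) Filter.atTop
      (nhds v) := by
  have hint : ∀ {g : X → ℝ}, Continuous g → Integrable g σ := fun hg =>
    hg.integrable_of_hasCompactSupport (HasCompactSupport.of_compactSpace _)
  obtain ⟨x₀, hx₀⟩ := hex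
  rw [Metric.tendsto_atTop]
  intro ε hε
  obtain ⟨M, hM⟩ := (isCompact_range
    (hf.sub continuous_const : Continuous fun x => f x - v)).isBounded.exists_norm_le
  have hM' : ∀ x, |f x - v| ≤ M := fun x => hM _ ⟨x, rfl⟩
  have hM0 : 0 ≤ M := (abs_nonneg _).trans (hM' x₀)
  set K := {x | ε / 2 ≤ |f x - v|} with hK
  have hKc : IsCompact K :=
    (isClosed_le continuous_const (by fun_prop)).isCompact
  obtain ⟨η, hη0, hη1, hηK⟩ : ∃ η : ℝ, 0 ≤ η ∧ η < 1 ∧ ∀ x ∈ K, c x ≤ η := by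
    rcases K.eq_empty_or_nonempty with h | h
    · exact ⟨0, le_rfl, one_pos, by simp [h]⟩
    · obtain ⟨x, hx, hmax⟩ := hKc.exists_isMaxOn h hc.continuousOn
      refine ⟨c x, hc0 x, lt_of_le_of_ne (hc1 x) fun h1 => ?_, fun y hy => hmax hy⟩
      have : ε / 2 ≤ |f x - v| := hx
      rw [hv x h1, sub_self, abs_zero] at this
      linarith
  obtain ⟨η', hηη', hη'1⟩ := exists_between hη1
  have hη'0 : 0 < η' := hη0.trans_lt hηη'
  set s := {x | η' < c x} with hs
  have hso : IsOpen s := isOpen_lt continuous_const hc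
  have hδ : 0 < σ.real s := by
    refine ENNReal.toReal_pos (hso.measure_pos σ ⟨x₀, ?_⟩).ne' (measure_ne_top _ _)
    rw [hs, Set.mem_ofPred_eq, hx₀]; exact hη'1
  have hlow : ∀ k : ℕ, η' ^ k * σ.real s ≤ ∫ x, c x ^ k ∂σ := fun k => by
    calc η' ^ k * σ.real s = ∫ _ in s, η' ^ k ∂σ := by simp [mul_comm]
      _ ≤ ∫ x in s, c x ^ k ∂σ := by
        refine setIntegral_mono_on (integrable_const _) (hint (by fun_prop)).integrableOn
          hso.measurableSet fun x hx => pow_le_pow_left₀ hη'0.le (le_of_lt hx) k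
      _ ≤ ∫ x, c x ^ k ∂σ :=
        setIntegral_le_integral (hint (by fun_prop))
          (Filter.Eventually.of_forall fun x => pow_nonneg (hc0 x) k)
  have hup : ∀ k : ℕ, |∫ x, (f x - v) * c x ^ k ∂σ|
      ≤ ε / 2 * ∫ x, c x ^ k ∂σ + M * η ^ k * σ.real Set.univ := fun k => by
    calc |∫ x, (f x - v) * c x ^ k ∂σ| ≤ ∫ x, |(f x - v) * c x ^ k| ∂σ :=
          abs_integral_le_integral_abs
      _ ≤ ∫ x, (ε / 2 * c x ^ k + M * η ^ k) ∂σ := by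
        refine integral_mono (hint (by fun_prop)) (hint (by fun_prop)) fun x => ?_
        have hck := pow_nonneg (hc0 x) k
        simp only [abs_mul, abs_of_nonneg hck]
        by_cases hx : x ∈ K
        · have h1 : |f x - v| * c x ^ k ≤ M * η ^ k :=
            mul_le_mul (hM' x) (pow_le_pow_left₀ (hc0 x) (hηK x hx) k) hck hM0
          have h2 : 0 ≤ ε / 2 * c x ^ k := by positivity
          linarith
        · have h1 : |f x - v| ≤ ε / 2 := le_of_lt (not_le.1 hx)
          have h2 : 0 ≤ M * η ^ k := by positivity
          have h3 := mul_le_mul_of_nonneg_right h1 hck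
          linarith
      _ = _ := by
        rw [integral_add (hint (by fun_prop)) (integrable_const _), integral_const_mul]
        simp [mul_comm]
  have hlim : Filter.Tendsto (fun k : ℕ => M * σ.real Set.univ / σ.real s * (η / η') ^ k)
      Filter.atTop (nhds 0) := by
    have := (tendsto_pow_atTop_nhds_zero_of_lt_one (div_nonneg hη0 hη'0.le)
      ((div_lt_one hη'0).2 hηη')).const_mul (M * σ.real Set.univ / σ.real s)
    simpa using this
  obtain ⟨N, hN⟩ := Filter.eventually_atTop.1 (hlim.eventually (gt_mem_nhds (half_pos hε)))
  refine ⟨N, fun k hk => ?_⟩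
  have hDpos : 0 < ∫ x, c x ^ k ∂σ := lt_of_lt_of_le (by positivity) (hlow k)
  have hsub : (∫ x, f x * c x ^ k ∂σ) / (∫ x, c x ^ k ∂σ) - v
      = (∫ x, (f x - v) * c x ^ k ∂σ) / ∫ x, c x ^ k ∂σ := by
    rw [eq_div_iff hDpos.ne', sub_mul, div_mul_cancel₀ _ hDpos.ne', ← integral_const_mul,
      ← integral_sub (hint (by fun_prop)) (hint (by fun_prop))]
    simp only [sub_mul]
  rw [Real.dist_eq, hsub, abs_div, abs_of_pos hDpos, div_lt_iff₀ hDpos]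
  have h1 : M * η ^ k * σ.real Set.univ
      ≤ M * σ.real Set.univ / σ.real s * (η / η') ^ k * ∫ x, c x ^ k ∂σ := by
    calc M * η ^ k * σ.real Set.univ
        = M * σ.real Set.univ / σ.real s * (η / η') ^ k * (η' ^ k * σ.real s) := by
          rw [div_pow]; field_simp
      _ ≤ _ := by
          have : 0 ≤ M * σ.real Set.univ / σ.real s * (η / η') ^ k := by positivity
          exact mul_le_mul_of_nonneg_left (hlow k) this
  have h2 := mul_lt_mul_of_pos_right (hN k hk) hDpos
  have h3 := hup k
  linarith

lemma integral_mul_polynomial_eq {X : Type*} [TopologicalSpace X] [CompactSpace X]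
    [MeasurableSpace X] [BorelSpace X] (σ : Measure X) [IsFiniteMeasure σ]
    {f a b : X → ℝ} (hf : Continuous f) (ha : Continuous a) (hb : Continuous b)
    (h : ∀ k : ℕ, ∫ x, f x * a x ^ k ∂σ = ∫ x, f x * b x ^ k ∂σ) (P : Polynomial ℝ) :
    ∫ x, f x * P.eval (a x) ∂σ = ∫ x, f x * P.eval (b x) ∂σ := by
  have key : ∀ {u : X → ℝ}, Continuous u → ∫ x, f x * P.eval (u x) ∂σ =
      ∑ i ∈ Finset.range (P.natDegree + 1), P.coeff i * ∫ x, f x * u x ^ i ∂σ := by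
    intro u hu
    simp only [← integral_const_mul]
    rw [← integral_finsetSum]
    · refine integral_congr_ae (Filter.Eventually.of_forall fun x => ?_)
      simp only [Polynomial.eval_eq_sum_range, Finset.mul_sum]
      exact Finset.sum_congr rfl fun i _ => by ring
    · intro i _
      exact (by fun_prop : Continuous fun x => P.coeff i * (f x * u x ^ i))
        |>.integrable_of_hasCompactSupport (HasCompactSupport.of_compactSpace _)
  rw [key ha, key hb]
  exact Finset.sum_congr rfl fun i _ => by rw [h i]

lemma hausdorffMeasure_inter_submodule_closedBall {n : ℕ} {F : Type*} [NormedAddCommGroup F]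
    [InnerProductSpace ℝ F] [MeasurableSpace F] [BorelSpace F] (H : Submodule ℝ F)
    [FiniteDimensional ℝ H] (hH : Module.finrank ℝ H = n) (r : ℝ) :
    μH[(n : ℝ)] (closedBall (0 : F) r ∩ (H : Set F)) =
      μH[(n : ℝ)] (closedBall (0 : EuclideanSpace ℝ (Fin n)) r) := by
  let φ : EuclideanSpace ℝ (Fin n) ≃ₗᵢ[ℝ] H :=
    ((stdOrthonormalBasis ℝ H).reindex (finCongr hH)).repr.symm
  let ψ : EuclideanSpace ℝ (Fin n) →ₗᵢ[ℝ] F := H.subtypeₗᵢ.comp φ.toLinearIsometry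
  have hψ : Set.range ψ = (H : Set F) := by
    have : (ψ : EuclideanSpace ℝ (Fin n) → F) = Subtype.val ∘ φ := rfl
    rw [this, φ.surjective.range_comp, Subtype.range_coe]
  have hpre : ψ ⁻¹' closedBall (0 : F) r = closedBall 0 r := by
    ext x
    simp
  rw [← hψ, ← ψ.isometry.hausdorffMeasure_preimage (Or.inl (Nat.cast_nonneg n)), hpre]

lemma integral_radial_mul_inner_sq_pow_eq (hBc : IsCompact B) (hBconv : Convex ℝ B)
    (hB0 : 0 ∈ interior B) {c : ℝ≥0∞}
    (hsec : ∀ H : Submodule ℝ (EuclideanSpace ℝ (Fin (m + 1 + 1))), Module.finrank ℝ H = m + 1 →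
      μH[((m + 1 : ℕ) : ℝ)] (B ∩ (H : Set (EuclideanSpace ℝ (Fin (m + 1 + 1))))) = c)
    (k : ℕ) {p q : EuclideanSpace ℝ (Fin (m + 1 + 1))} (hp : ‖p‖ = 1) (hq : ‖q‖ = 1) :
    ∫ θ : sphere (0 : EuclideanSpace ℝ (Fin (m + 1 + 1))) 1, (gauge B θ)⁻¹ ^ (m + 1) *
        (inner ℝ (θ : EuclideanSpace ℝ (Fin (m + 1 + 1))) p ^ 2) ^ k ∂(volume.toSphere) =
      ∫ θ : sphere (0 : EuclideanSpace ℝ (Fin (m + 1 + 1))) 1, (gauge B θ)⁻¹ ^ (m + 1) *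
        (inner ℝ (θ : EuclideanSpace ℝ (Fin (m + 1 + 1))) q ^ 2) ^ k ∂(volume.toSphere) := by
  have := integral_mul_polynomial_eq volume.toSphere (continuous_radial hBc hBconv hB0)
    (a := fun θ : sphere (0 : EuclideanSpace ℝ (Fin (m + 1 + 1))) 1 =>
      1 - inner ℝ (θ : EuclideanSpace ℝ (Fin (m + 1 + 1))) p ^ 2)
    (b := fun θ : sphere (0 : EuclideanSpace ℝ (Fin (m + 1 + 1))) 1 =>
      1 - inner ℝ (θ : EuclideanSpace ℝ (Fin (m + 1 + 1))) q ^ 2)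
    (by fun_prop) (by fun_prop)
    (fun k => sphereIntegral_eq_of_norm_eq_one hBc hBconv hB0 hsec k hp hq)
    ((1 - Polynomial.X) ^ k)
  simpa using this

lemma integral_inner_sq_pow_eq (k : ℕ) {p q : EuclideanSpace ℝ (Fin (m + 1 + 1))}
    (hp : ‖p‖ = 1) (hq : ‖q‖ = 1) :
    ∫ θ : sphere (0 : EuclideanSpace ℝ (Fin (m + 1 + 1))) 1,
        (inner ℝ (θ : EuclideanSpace ℝ (Fin (m + 1 + 1))) p ^ 2) ^ k ∂(volume.toSphere) =
      ∫ θ : sphere (0 : EuclideanSpace ℝ (Fin (m + 1 + 1))) 1,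
        (inner ℝ (θ : EuclideanSpace ℝ (Fin (m + 1 + 1))) q ^ 2) ^ k ∂(volume.toSphere) := by
  have h0 : (0 : EuclideanSpace ℝ (Fin (m + 1 + 1))) ∈ interior (closedBall 0 1) :=
    mem_interior_iff_mem_nhds.2 (closedBall_mem_nhds _ one_pos)
  have := integral_radial_mul_inner_sq_pow_eq (isCompact_closedBall _ _) (convex_closedBall _ _)
    h0 (fun H hH => hausdorffMeasure_inter_submodule_closedBall H hH 1) k hp hq
  simpa [gauge_closedBall zero_le_one] using this

lemma gauge_eq_of_norm_eq_one (hBc : IsCompact B) (hBconv : Convex ℝ B) (hBsym : B = -B)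
    (hB0 : 0 ∈ interior B) {c : ℝ≥0∞}
    (hsec : ∀ H : Submodule ℝ (EuclideanSpace ℝ (Fin (m + 1 + 1))), Module.finrank ℝ H = m + 1 →
      μH[((m + 1 : ℕ) : ℝ)] (B ∩ (H : Set (EuclideanSpace ℝ (Fin (m + 1 + 1))))) = c)
    {p q : EuclideanSpace ℝ (Fin (m + 1 + 1))} (hp : ‖p‖ = 1) (hq : ‖q‖ = 1) :
    gauge B p = gauge B q := by
  have hneg : ∀ x, gauge B (-x) = gauge B x := fun x =>
    gauge_neg (fun y hy => by rw [hBsym]; simpa using hy) x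
  have key : ∀ w : EuclideanSpace ℝ (Fin (m + 1 + 1)), ‖w‖ = 1 → _ := fun w hw =>
    tendsto_integral_mul_pow_div
      (volume : Measure (EuclideanSpace ℝ (Fin (m + 1 + 1)))).toSphere
      (continuous_radial hBc hBconv hB0)
      (c := fun θ => inner ℝ (θ : EuclideanSpace ℝ (Fin (m + 1 + 1))) w ^ 2) (by fun_prop)
      (fun θ => sq_nonneg _) (fun θ => inner_sq_le_one θ hw) (v := (gauge B w)⁻¹ ^ (m + 1))
      (fun θ hθ => by
        have hn : ‖(θ : EuclideanSpace ℝ (Fin (m + 1 + 1)))‖ = 1 := norm_eq_of_mem_sphere θ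
        rcases sq_eq_one_iff.1 hθ with h | h
        · rw [(inner_eq_one_iff_of_norm_eq_one hn hw).1 h]
        · rw [(inner_eq_neg_one_iff_of_norm_eq_one hn hw).1 h, hneg])
      ⟨⟨w, by simpa using hw⟩, by simp [hw]⟩
  have h1 := key p hp
  simp only [integral_radial_mul_inner_sq_pow_eq hBc hBconv hB0 hsec _ hp hq,
    integral_inner_sq_pow_eq _ hp hq] at h1
  have h2 := tendsto_nhds_unique h1 (key q hq)
  exact inv_injective ((pow_left_inj₀ (inv_nonneg.2 (gauge_nonneg _))
    (inv_nonneg.2 (gauge_nonneg _)) m.succ_ne_zero).1 h2)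

end CentralSections

end

/-- If all hyperplane sections through the origin of a symmetric convex body
`B ⊆ ℝ^{n+1}` have the same `n`-dimensional volume, then `B` is a ball centered at the origin. -/
theorem equal_central_sections_of_symmetric_body_implies_ball
    (n : ℕ) (hn : 2 ≤ n)
    (B : Set (EuclideanSpace ℝ (Fin (n + 1))))
    (hBcompact : IsCompact B) (hBconv : Convex ℝ B)
    (hBsym : B = -B)
    (hB0 : (0 : EuclideanSpace ℝ (Fin (n + 1))) ∈ interior B)
    (c : ℝ≥0∞)
    (hsec : ∀ H : Submodule ℝ (EuclideanSpace ℝ (Fin (n + 1))),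
      Module.finrank ℝ H = n →
        μH[(n : ℝ)] (B ∩ (H : Set (EuclideanSpace ℝ (Fin (n + 1))))) = c) :
    ∃ r : ℝ, 0 < r ∧ B = closedBall 0 r := by
  obtain ⟨m, rfl⟩ : ∃ m, n = m + 1 := ⟨n - 1, by omega⟩
  obtain ⟨e, he⟩ := exists_norm_eq (EuclideanSpace ℝ (Fin (m + 1 + 1))) zero_le_one
  have he0 : e ≠ 0 := norm_ne_zero_iff.1 (he ▸ one_ne_zero)
  have hg : 0 < gauge B e := CentralSections.gauge_pos_of_isCompact hBcompact hB0 he0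
  refine ⟨(gauge B e)⁻¹, inv_pos.2 hg, ?_⟩
  ext x
  have hx : gauge B x = ‖x‖ * gauge B e := by
    rcases eq_or_ne x 0 with rfl | hx
    · simp
    · have hx1 : ‖‖x‖⁻¹ • x‖ = 1 := norm_smul_inv_norm (𝕜 := ℝ) hx
      rw [← CentralSections.gauge_eq_of_norm_eq_one hBcompact hBconv hBsym hB0 hsec hx1 he,
        ← smul_eq_mul, ← gauge_smul_of_nonneg (norm_nonneg x),
        smul_inv_smul₀ (norm_ne_zero_iff.2 hx)]
  rw [CentralSections.mem_iff_gauge_le_one hBcompact hBconv hB0, hx, mem_closedBall_zero_iff,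
    ← one_div, le_div_iff₀ hg]
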